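/- Let a codeword of K3 have exactly one of its three sub-blocks nonzero. Then the Hamming weight of the codeword is at least n - k + 3s + 1. (That is, with t = 2s, the D_1-minimum-distance of K3 is at least n - k + 3t/2 + 1.) -/

import Mathlib

open Polynomial

theorem K3_sep {F : Type*} [Field F] (m : ℕ) (A B : F[X]) (hA : A.degree < (m : WithBot ℕ))
    (h : A + X ^ m * B = 0) : A = 0 ∧ B = 0 := by
  have hB : B = 0 := by
    ext i
    have h1 := congrArg (fun p => coeff p (i + m)) h
    simp only [coeff_add, coeff_X_pow_mul, coeff_zero] at h1
    rw [coeff_eq_zero_of_degree_lt (lt_of_lt_of_le hA (by exact_mod_cast Nat.le_add_left m i)),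
      zero_add] at h1
    simpa using h1
  subst hB
  simpa using h

theorem K3_deg {F : Type*} [Field F] (m r N : ℕ) (A B : F[X]) (hA : A.degree < (m : WithBot ℕ))
    (hB : B.degree < (r : WithBot ℕ)) (hN : N = m + r) :
    (A + X ^ m * B).degree < (N : WithBot ℕ) := by
  subst hN
  rw [degree_lt_iff_coeff_zero] at *
  intro i hi
  rw [coeff_add, hA i (by omega), coeff_X_pow_mul', if_pos (by omega), hB _ (by omega), zero_add]

theorem K3_add {F : Type*} [Field F] (m : ℕ) (A B : F[X]) (hA : A.degree < (m : WithBot ℕ))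
    (hB : B.degree < (m : WithBot ℕ)) : (A + B).degree < (m : WithBot ℕ) :=
  lt_of_le_of_lt (degree_add_le _ _) (max_lt hA hB)

/-- Lemma 3: if a codeword of `K3` has exactly one nonzero sub-block, then its Hamming weight
is at least `n - k + 3s + 1` (the D₁-minimum-distance of `K3`). -/
theorem K3_D1_distance
    (F : Type*) [Field F] [Fintype F] [DecidableEq F]
    (n k s : ℕ) (hn : 0 < n) (hk : 0 < k) (hs : 0 < s)
    (h4s : 4 * s < k) (hks : k + 2 * s ≤ n)
    (hdvd : n ∣ Fintype.card F - 1)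
    (α : F) (hα : orderOf α = n)
    -- the information vector: for each sub-unit j, polynomials V_{j,1},…,V_{j,4}
    -- of degree ≤ s-1 and V_{j,I} of degree ≤ k-4s-1
    (V1 V2 V3 V4 VI : Fin 3 → F[X])
    (hV1 : ∀ j, (V1 j).degree < (s : WithBot ℕ))
    (hV2 : ∀ j, (V2 j).degree < (s : WithBot ℕ))
    (hV3 : ∀ j, (V3 j).degree < (s : WithBot ℕ))
    (hV4 : ∀ j, (V4 j).degree < (s : WithBot ℕ))
    (hVI : ∀ j, (VI j).degree < ((k - 4 * s : ℕ) : WithBot ℕ))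
    -- the sub-block polynomials c_j (indices of sub-units taken mod 3)
    (c : Fin 3 → F[X])
    (hc : ∀ j, c j = V1 j + X ^ s * V2 j + X ^ (2 * s) * (V3 j + V4 j)
          + X ^ (3 * s) * V4 j + X ^ (4 * s) * VI j
          + X ^ k * (V2 (j - 1) + V3 (j + 1) + V4 (j + 1))
          + X ^ (k + s) * V1 (j - 1))
    -- the sub-blocks of the codeword: evaluations of c_j at α^0, …, α^{n-1}
    (w : Fin 3 → Fin n → F)
    (hw : ∀ j (i : Fin n), w j i = (c j).eval (α ^ (i : ℕ)))
    (hone : (Finset.univ.filter fun j : Fin 3 => w j ≠ 0).card = 1) :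
    n - k + 3 * s + 1 ≤ ∑ j : Fin 3, hammingNorm (w j) := by
  have hinj : Function.Injective (fun i : Fin n => α ^ (i : ℕ)) := by
    intro a b hab
    apply Fin.ext
    exact pow_injOn_Iio_orderOf (by simp [hα]) (by simp [hα]) hab
  have key : ∀ j, w j = 0 → V1 j = 0 ∧ V2 j = 0 ∧ V3 j = 0 ∧ V4 j = 0 ∧ VI j = 0 ∧
      V2 (j - 1) + V3 (j + 1) + V4 (j + 1) = 0 ∧ V1 (j - 1) = 0 := by
    intro j hj
    have d1 := K3_deg s s (2 * s) _ _ (hV1 j) (hV2 j) (by omega)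
    have d2 := K3_deg (2 * s) s (3 * s) _ _ d1 (K3_add s _ _ (hV3 j) (hV4 j)) (by omega)
    have d3 := K3_deg (3 * s) s (4 * s) _ _ d2 (hV4 j) (by omega)
    have d4 := K3_deg (4 * s) (k - 4 * s) k _ _ d3 (hVI j) (by omega)
    have d5 := K3_deg k s (k + s) _ _ d4
      (K3_add s _ _ (K3_add s _ _ (hV2 (j - 1)) (hV3 (j + 1))) (hV4 (j + 1))) (by omega)
    have d6 := K3_deg (k + s) s (k + 2 * s) _ _ d5 (hV1 (j - 1)) (by omega)
    have hc0 : c j = 0 := by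
      refine eq_zero_of_degree_lt_of_eval_index_eq_zero (s := Finset.univ)
        (v := fun i : Fin n => α ^ (i : ℕ)) hinj.injOn ?_ ?_
      · rw [hc j]
        refine lt_of_lt_of_le d6 ?_
        simpa using (by exact_mod_cast hks : ((k + 2 * s : ℕ) : WithBot ℕ) ≤ (n : WithBot ℕ))
      · intro i _
        rw [← hw, hj]; rfl
    rw [hc j] at hc0
    obtain ⟨e5, f6⟩ := K3_sep _ _ _ d5 hc0
    obtain ⟨e4, f5⟩ := K3_sep _ _ _ d4 e5
    obtain ⟨e3, f4⟩ := K3_sep _ _ _ d3 e4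
    obtain ⟨e2, f3⟩ := K3_sep _ _ _ d2 e3
    obtain ⟨e1, f2⟩ := K3_sep _ _ _ d1 e2
    obtain ⟨e0, f1⟩ := K3_sep _ _ _ (hV1 j) e1
    rw [f3, add_zero] at f2
    exact ⟨e0, f1, f2, f3, f4, f5, f6⟩
  obtain ⟨j, hj⟩ := Finset.card_eq_one.mp hone
  have hmem : ∀ i, w i ≠ 0 ↔ i = j := by
    intro i
    have := congrArg (fun S => i ∈ S) hj
    simpa using this
  have hwj : w j ≠ 0 := (hmem j).2 rfl
  have hz : ∀ i, i ≠ j → w i = 0 := fun i hi => by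
    by_contra h
    exact hi ((hmem i).1 h)
  obtain ⟨a1, a2, a3, a4, aI, aS, aT⟩ := key (j + 1) (hz _ (by clear * -; revert j; decide))
  obtain ⟨b1, b2, b3, b4, bI, bS, bT⟩ := key (j - 1) (hz _ (by clear * -; revert j; decide))
  have i1 : j + 1 - 1 = j := by clear * -; revert j; decide
  have i2 : j + 1 + 1 = j - 1 := by clear * -; revert j; decide
  have i3 : j - 1 - 1 = j + 1 := by clear * -; revert j; decide
  have i4 : j - 1 + 1 = j := by clear * -; revert j; decide
  rw [i1, i2, b3, b4, add_zero, add_zero] at aS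
  rw [i1] at aT
  rw [i3, i4, a2, zero_add] at bS
  have hcj : c j = X ^ (3 * s) * (V4 j + X ^ s * VI j) := by
    rw [hc j, aT, aS, bS, b2, b1, a3, a4]
    ring
  have hα0 : α ≠ 0 := by
    rintro rfl
    simp at hα
    omega
  have hdeg := K3_deg s (k - 4 * s) (k - 3 * s) _ _ (hV4 j) (hVI j) (by omega)
  have hlt : (Finset.univ.filter fun i : Fin n => w j i = 0).card < k - 3 * s := by
    by_contra hge
    push Not at hge
    apply hwj
    have h0 : V4 j + X ^ s * VI j = 0 := by
      refine eq_zero_of_degree_lt_of_eval_index_eq_zero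
        (s := Finset.univ.filter fun i : Fin n => w j i = 0)
        (v := fun i : Fin n => α ^ (i : ℕ)) hinj.injOn ?_ ?_
      · exact lt_of_lt_of_le hdeg (by exact_mod_cast hge)
      · intro i hi
        have hi' := (Finset.mem_filter.mp hi).2
        rw [hw, hcj, eval_mul, eval_pow, eval_X] at hi'
        exact (mul_eq_zero.mp hi').resolve_left (pow_ne_zero _ (pow_ne_zero _ hα0))
    funext i
    rw [hw, hcj, h0]
    simp
  have hsum : hammingNorm (w j) ≤ ∑ j : Fin 3, hammingNorm (w j) :=
    Finset.single_le_sum (f := fun j => hammingNorm (w j)) (fun _ _ => Nat.zero_le _)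
      (Finset.mem_univ j)
  have hcount := Finset.card_filter_add_card_filter_not (s := (Finset.univ : Finset (Fin n)))
    (fun i : Fin n => w j i = 0)
  rw [Finset.card_univ, Fintype.card_fin] at hcount
  have hh : hammingNorm (w j) = (Finset.univ.filter fun i : Fin n => ¬ w j i = 0).card := rfl
  omega
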